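/- Let μ > 1, α ∈ ℝ, T* > 0. Set β_μ(t) = (μ−1)/(T*−t) for 0 ≤ t < T*, ρ(t) = μ/(2(T*−t)), V^{lin}(x,t) = ρ(t)(−x₁,−x₂,2x₃), and define the singular Burgers vortex V^{sB}(x,t) = V^{lin}(x,t) + α √(β_μ(t)) U^G(√(β_μ(t)) x') together with the pressure P^{sB}(x,t) = −(1/2)(∂_t V^{lin})(x,t)·x − (1/2)|V^{sB}(x,t)|² − (α² β_μ(t)/(16π²)) ∫_{β_μ(t)|x'|²}^{∞} (1/r)(1 − e^{−r/4}) e^{−r/4} dr, where x' = (x₁,x₂). Then for every 0 ≤ t < T* and every x ∈ ℝ³ with x' ≠ 0, the pair (V^{sB}, P^{sB}) solves the Navier–Stokes equations: ∂_t V^{sB} − ΔV^{sB} + ∇P^{sB} + (V^{sB}·∇)V^{sB} = 0 and ∇·V^{sB} = 0. -/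

import Mathlib

open MeasureTheory

noncomputable section

/-- Partial derivative in the `i`-th coordinate direction of a scalar function on `ℝ³`. -/
def pd (i : Fin 3) (f : (Fin 3 → ℝ) → ℝ) (x : Fin 3 → ℝ) : ℝ :=
  fderiv ℝ f x (Pi.single i 1)

/-- The axisymmetric strain vector `(-x₁, -x₂, 2x₃)`. -/
def strainVec (x : Fin 3 → ℝ) : Fin 3 → ℝ := ![-(x 0), -(x 1), 2 * x 2]

/-- The Burgers vortex velocity profile
`U^G(ξ') = ((1 - e^{-|ξ'|²/4})/(2π|ξ'|²)) (-ξ₂, ξ₁, 0)`, viewed with values in `ℝ³`. -/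
def UG3 (ξ : Fin 2 → ℝ) : Fin 3 → ℝ :=
  ((1 - Real.exp (-(ξ 0 ^ 2 + ξ 1 ^ 2) / 4)) / (2 * Real.pi * (ξ 0 ^ 2 + ξ 1 ^ 2))) •
    ![-(ξ 1), ξ 0, 0]

/-- The time-dependent strain-rate scale `β_μ(t) = (μ-1)/(T*-t)`. -/
def βμ (μ T t : ℝ) : ℝ := (μ - 1) / (T - t)

/-- The singular Burgers vortex velocity field. -/
def VsB (μ α T t : ℝ) (x : Fin 3 → ℝ) : Fin 3 → ℝ :=
  (μ / (2 * (T - t))) • strainVec x +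
    (α * Real.sqrt (βμ μ T t)) •
      UG3 ![Real.sqrt (βμ μ T t) * x 0, Real.sqrt (βμ μ T t) * x 1]

/-- The singular Burgers vortex pressure. -/
def PsB (μ α T t : ℝ) (x : Fin 3 → ℝ) : ℝ :=
  -(1 / 2) * (∑ i, (deriv (fun s => (μ / (2 * (T - s))) * strainVec x i) t) * x i) -
    (1 / 2) * (∑ i, (VsB μ α T t x i) ^ 2) -
    (α ^ 2 * βμ μ T t / (16 * Real.pi ^ 2)) *
      ∫ r in Set.Ioi (βμ μ T t * (x 0 ^ 2 + x 1 ^ 2)),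
        (1 / r) * (1 - Real.exp (-r / 4)) * Real.exp (-r / 4)

/-- `f` is differentiable at `x` with gradient `d`. -/
def HasGrad (f : (Fin 3 → ℝ) → ℝ) (d x : Fin 3 → ℝ) : Prop :=
  HasFDerivAt f (∑ j, d j • ContinuousLinearMap.proj (R := ℝ) (φ := fun _ : Fin 3 => ℝ) j) x

namespace HasGrad

variable {f g : (Fin 3 → ℝ) → ℝ} {d e x : Fin 3 → ℝ}

theorem pd_eq (h : HasGrad f d x) (i : Fin 3) : pd i f x = d i := by
  rw [pd, HasFDerivAt.fderiv h]
  simp [Pi.single_apply]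

theorem coord (k : Fin 3) (x : Fin 3 → ℝ) : HasGrad (fun y => y k) (Pi.single k 1) x := by
  refine (hasFDerivAt_apply (𝕜 := ℝ) (F' := fun _ : Fin 3 => ℝ) k x).congr_fderiv ?_
  ext v
  simp [Pi.single_apply]

theorem const (c : ℝ) (x : Fin 3 → ℝ) : HasGrad (fun _ => c) 0 x := by
  refine (hasFDerivAt_const (𝕜 := ℝ) c x).congr_fderiv ?_
  ext v
  simp

theorem add (hf : HasGrad f d x) (hg : HasGrad g e x) :
    HasGrad (fun y => f y + g y) (d + e) x := by
  refine (HasFDerivAt.add hf hg).congr_fderiv ?_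
  simp [add_smul, Finset.sum_add_distrib]

theorem mul (hf : HasGrad f d x) (hg : HasGrad g e x) :
    HasGrad (fun y => f y * g y) (f x • e + g x • d) x := by
  refine (HasFDerivAt.mul hf hg).congr_fderiv ?_
  simp [add_smul, Finset.sum_add_distrib, Finset.smul_sum, smul_smul]

theorem const_mul (c : ℝ) (hf : HasGrad f d x) : HasGrad (fun y => c * f y) (c • d) x := by
  refine (HasFDerivAt.const_mul hf c).congr_fderiv ?_
  simp [Finset.smul_sum, smul_smul]

theorem comp {φ : ℝ → ℝ} {φ' : ℝ} (hφ : HasDerivAt φ φ' (f x)) (hf : HasGrad f d x) :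
    HasGrad (fun y => φ (f y)) (φ' • d) x := by
  refine (hφ.comp_hasFDerivAt x hf).congr_fderiv ?_
  simp [Finset.smul_sum, smul_smul]

theorem congr (hf : HasGrad f d x) (hfg : ∀ y, g y = f y) (hde : d = e) : HasGrad g e x := by
  obtain rfl : g = f := funext hfg
  exact hde ▸ hf

end HasGrad

theorem pd_congr {f g : (Fin 3 → ℝ) → ℝ} {x : Fin 3 → ℝ} (h : f =ᶠ[nhds x] g) (i : Fin 3) :
    pd i f x = pd i g x := by
  rw [pd, pd, h.fderiv_eq]

/-- The squared distance to the vortex axis. -/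
def axisDistSq (x : Fin 3 → ℝ) : ℝ := x 0 ^ 2 + x 1 ^ 2

theorem axisDistSq_pos {x : Fin 3 → ℝ} (hx : ¬(x 0 = 0 ∧ x 1 = 0)) : 0 < axisDistSq x := by
  unfold axisDistSq
  by_cases h0 : x 0 = 0
  · have h1 : x 1 ≠ 0 := fun h => hx ⟨h0, h⟩
    positivity
  · positivity

theorem eventually_axisDistSq_pos {x : Fin 3 → ℝ} (hx : 0 < axisDistSq x) :
    ∀ᶠ y in nhds x, 0 < axisDistSq y := by
  have hc : Continuous axisDistSq := by unfold axisDistSq; fun_prop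
  exact hc.continuousAt.eventually (lt_mem_nhds hx)

theorem hasGrad_axisDistSq (x : Fin 3 → ℝ) :
    HasGrad axisDistSq ![2 * x 0, 2 * x 1, 0] x := by
  refine (((HasGrad.coord 0 x).mul (HasGrad.coord 0 x)).add
    ((HasGrad.coord 1 x).mul (HasGrad.coord 1 x))).congr (fun y => ?_) ?_
  · simp only [axisDistSq]; ring
  · ext i; fin_cases i <;> simp <;> ring

/-- The radial profile of the angular velocity of the vortex, as a function of the squared
distance to the axis. -/
def swirl (b s : ℝ) : ℝ := (1 - Real.exp (-(b * s) / 4)) / s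

/-- The first derivative of `swirl`. -/
def swirlDeriv (b s : ℝ) : ℝ :=
  b / 4 * Real.exp (-(b * s) / 4) / s - (1 - Real.exp (-(b * s) / 4)) / s ^ 2

/-- The second derivative of `swirl`. -/
def swirlDeriv₂ (b s : ℝ) : ℝ :=
  -(b ^ 2 / 16) * Real.exp (-(b * s) / 4) / s - b / 2 * Real.exp (-(b * s) / 4) / s ^ 2 +
    2 * (1 - Real.exp (-(b * s) / 4)) / s ^ 3

theorem hasDerivAt_exp_neg_mul_div_four (b s : ℝ) :
    HasDerivAt (fun r => Real.exp (-(b * r) / 4)) (-(b / 4) * Real.exp (-(b * s) / 4)) s := by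
  refine ((((hasDerivAt_id s).const_mul b).neg).div_const 4).exp.congr_deriv ?_
  simp only [Pi.neg_apply, id]
  ring

theorem hasDerivAt_swirl (b : ℝ) {s : ℝ} (hs : 0 < s) :
    HasDerivAt (swirl b) (swirlDeriv b s) s := by
  refine (((hasDerivAt_exp_neg_mul_div_four b s).const_sub 1).div
    (hasDerivAt_id s) hs.ne').congr_deriv ?_
  simp only [swirlDeriv, id]
  field_simp

theorem hasDerivAt_swirlDeriv (b : ℝ) {s : ℝ} (hs : 0 < s) :
    HasDerivAt (swirlDeriv b) (swirlDeriv₂ b s) s := by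
  have hE := hasDerivAt_exp_neg_mul_div_four b s
  refine (((hE.const_mul (b / 4)).div (hasDerivAt_id s) hs.ne').sub
    ((hE.const_sub 1).div (hasDerivAt_pow 2 s) (pow_ne_zero 2 hs.ne'))).congr_deriv ?_
  simp only [swirlDeriv₂, id]
  field_simp
  ring

theorem sqrt_mul_profile_eq_swirl {b : ℝ} (hb : 0 < b) (u v w : ℝ) :
    √b * ((1 - Real.exp (-((√b * u) ^ 2 + (√b * v) ^ 2) / 4)) /
        (2 * Real.pi * ((√b * u) ^ 2 + (√b * v) ^ 2)) * (√b * w)) =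
      1 / (2 * Real.pi) * (w * swirl b (u ^ 2 + v ^ 2)) := by
  have hsq : √b * √b = b := Real.mul_self_sqrt hb.le
  have h : (√b * u) ^ 2 + (√b * v) ^ 2 = b * (u ^ 2 + v ^ 2) := by
    linear_combination (u ^ 2 + v ^ 2) * hsq
  rw [h, swirl]
  generalize 1 - Real.exp (-(b * (u ^ 2 + v ^ 2)) / 4) = E
  calc _ = √b * √b * (E / (2 * Real.pi * (b * (u ^ 2 + v ^ 2))) * w) := by ring
    _ = _ := by
      rw [hsq]
      field_simp

theorem VsB_apply_zero (μ α T t : ℝ) (hβ : 0 < βμ μ T t) (y : Fin 3 → ℝ) :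
    VsB μ α T t y 0 = -(μ / (2 * (T - t))) * y 0 +
      -(α / (2 * Real.pi)) * (y 1 * swirl (βμ μ T t) (axisDistSq y)) := by
  have h := sqrt_mul_profile_eq_swirl hβ (y 0) (y 1) (y 1)
  simp only [VsB, strainVec, UG3, axisDistSq, Pi.add_apply, Pi.smul_apply, smul_eq_mul,
    Matrix.cons_val]
  linear_combination -α * h

theorem VsB_apply_one (μ α T t : ℝ) (hβ : 0 < βμ μ T t) (y : Fin 3 → ℝ) :
    VsB μ α T t y 1 = -(μ / (2 * (T - t))) * y 1 +
      α / (2 * Real.pi) * (y 0 * swirl (βμ μ T t) (axisDistSq y)) := by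
  have h := sqrt_mul_profile_eq_swirl hβ (y 0) (y 1) (y 0)
  simp only [VsB, strainVec, UG3, axisDistSq, Pi.add_apply, Pi.smul_apply, smul_eq_mul,
    Matrix.cons_val]
  linear_combination α * h

theorem VsB_apply_two (μ α T t : ℝ) (y : Fin 3 → ℝ) :
    VsB μ α T t y 2 = 2 * (μ / (2 * (T - t))) * y 2 := by
  simp [VsB, strainVec, UG3]
  ring

theorem hasGrad_VsB_zero (μ α T t : ℝ) (hβ : 0 < βμ μ T t) {y : Fin 3 → ℝ}
    (hy : 0 < axisDistSq y) :
    HasGrad (fun z => VsB μ α T t z 0)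
      ![-(μ / (2 * (T - t))) +
          -(α / Real.pi) * (y 0 * y 1 * swirlDeriv (βμ μ T t) (axisDistSq y)),
        -(α / (2 * Real.pi)) * (swirl (βμ μ T t) (axisDistSq y) +
          2 * y 1 ^ 2 * swirlDeriv (βμ μ T t) (axisDistSq y)), 0] y := by
  have hg := HasGrad.comp (hasDerivAt_swirl (βμ μ T t) hy) (hasGrad_axisDistSq y)
  refine (((HasGrad.coord 0 y).const_mul _).add
    (((HasGrad.coord 1 y).mul hg).const_mul _)).congr (VsB_apply_zero μ α T t hβ) ?_
  ext i
  simp only [Pi.add_apply, Pi.smul_apply, smul_eq_mul]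
  fin_cases i <;> simp [-mul_eq_mul_left_iff] <;> ring

theorem hasGrad_VsB_one (μ α T t : ℝ) (hβ : 0 < βμ μ T t) {y : Fin 3 → ℝ}
    (hy : 0 < axisDistSq y) :
    HasGrad (fun z => VsB μ α T t z 1)
      ![α / (2 * Real.pi) * (swirl (βμ μ T t) (axisDistSq y) +
          2 * y 0 ^ 2 * swirlDeriv (βμ μ T t) (axisDistSq y)),
        -(μ / (2 * (T - t))) +
          α / Real.pi * (y 0 * y 1 * swirlDeriv (βμ μ T t) (axisDistSq y)), 0] y := by
  have hg := HasGrad.comp (hasDerivAt_swirl (βμ μ T t) hy) (hasGrad_axisDistSq y)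
  refine (((HasGrad.coord 1 y).const_mul _).add
    (((HasGrad.coord 0 y).mul hg).const_mul _)).congr (VsB_apply_one μ α T t hβ) ?_
  ext i
  simp only [Pi.add_apply, Pi.smul_apply, smul_eq_mul]
  fin_cases i <;> simp [-mul_eq_mul_left_iff] <;> ring

theorem hasGrad_VsB_two (μ α T t : ℝ) (y : Fin 3 → ℝ) :
    HasGrad (fun z => VsB μ α T t z 2) ![0, 0, 2 * (μ / (2 * (T - t)))] y := by
  refine ((HasGrad.coord 2 y).const_mul _).congr (VsB_apply_two μ α T t) ?_
  ext i; fin_cases i <;> simp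

theorem laplacian_VsB_zero (μ α T t : ℝ) (hβ : 0 < βμ μ T t) {x : Fin 3 → ℝ}
    (hx : 0 < axisDistSq x) :
    ∑ j, pd j (fun y => pd j (fun z => VsB μ α T t z 0) y) x =
      -(α / Real.pi) * x 1 * (4 * swirlDeriv (βμ μ T t) (axisDistSq x) +
        2 * axisDistSq x * swirlDeriv₂ (βμ μ T t) (axisDistSq x)) := by
  have hpd (j : Fin 3) := pd_congr ((eventually_axisDistSq_pos hx).mono
    fun y hy => (hasGrad_VsB_zero μ α T t hβ hy).pd_eq j) j
  have hg := HasGrad.comp (hasDerivAt_swirl (βμ μ T t) hx) (hasGrad_axisDistSq x)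
  have hg₁ := HasGrad.comp (hasDerivAt_swirlDeriv (βμ μ T t) hx) (hasGrad_axisDistSq x)
  have h₀ := (HasGrad.const (-(μ / (2 * (T - t)))) x).add
    ((((HasGrad.coord 0 x).mul (HasGrad.coord 1 x)).mul hg₁).const_mul (-(α / Real.pi)))
  have h₁ := (hg.add ((((HasGrad.coord 1 x).mul (HasGrad.coord 1 x)).const_mul 2).mul
    hg₁)).const_mul (-(α / (2 * Real.pi)))
  have e₀ := h₀.pd_eq 0
  have e₁ := h₁.pd_eq 1
  have e₂ := (HasGrad.const 0 x).pd_eq 2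
  rw [Fin.sum_univ_three, hpd, hpd, hpd]
  simp only [Matrix.cons_val, pow_two] at e₀ e₁ e₂ ⊢
  rw [e₀, e₁, e₂]
  simp only [Pi.add_apply, Pi.smul_apply, Pi.zero_apply, smul_eq_mul]
  simp [axisDistSq]
  ring

theorem laplacian_VsB_one (μ α T t : ℝ) (hβ : 0 < βμ μ T t) {x : Fin 3 → ℝ}
    (hx : 0 < axisDistSq x) :
    ∑ j, pd j (fun y => pd j (fun z => VsB μ α T t z 1) y) x =
      α / Real.pi * x 0 * (4 * swirlDeriv (βμ μ T t) (axisDistSq x) +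
        2 * axisDistSq x * swirlDeriv₂ (βμ μ T t) (axisDistSq x)) := by
  have hpd (j : Fin 3) := pd_congr ((eventually_axisDistSq_pos hx).mono
    fun y hy => (hasGrad_VsB_one μ α T t hβ hy).pd_eq j) j
  have hg := HasGrad.comp (hasDerivAt_swirl (βμ μ T t) hx) (hasGrad_axisDistSq x)
  have hg₁ := HasGrad.comp (hasDerivAt_swirlDeriv (βμ μ T t) hx) (hasGrad_axisDistSq x)
  have h₁ := (HasGrad.const (-(μ / (2 * (T - t)))) x).add
    ((((HasGrad.coord 0 x).mul (HasGrad.coord 1 x)).mul hg₁).const_mul (α / Real.pi))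
  have h₀ := (hg.add ((((HasGrad.coord 0 x).mul (HasGrad.coord 0 x)).const_mul 2).mul
    hg₁)).const_mul (α / (2 * Real.pi))
  have e₀ := h₀.pd_eq 0
  have e₁ := h₁.pd_eq 1
  have e₂ := (HasGrad.const 0 x).pd_eq 2
  rw [Fin.sum_univ_three, hpd, hpd, hpd]
  simp only [Matrix.cons_val, pow_two] at e₀ e₁ e₂ ⊢
  rw [e₀, e₁, e₂]
  simp only [Pi.add_apply, Pi.smul_apply, Pi.zero_apply, smul_eq_mul]
  simp [axisDistSq]
  ring

theorem laplacian_VsB_two (μ α T t : ℝ) (x : Fin 3 → ℝ) :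
    ∑ j, pd j (fun y => pd j (fun z => VsB μ α T t z 2) y) x = 0 := by
  have hpd (j : Fin 3) :
      (fun y => pd j (fun z => VsB μ α T t z 2) y) =
        fun _ => (![0, 0, 2 * (μ / (2 * (T - t)))] : Fin 3 → ℝ) j :=
    funext fun y => (hasGrad_VsB_two μ α T t y).pd_eq j
  exact Finset.sum_eq_zero fun j _ => by rw [hpd, (HasGrad.const _ x).pd_eq]; rfl

theorem hasDerivAt_strain_rate (μ T : ℝ) {t : ℝ} (ht : t < T) :
    HasDerivAt (fun s => μ / (2 * (T - s))) (μ / (2 * (T - t) ^ 2)) t := by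
  have h : T - t ≠ 0 := by linarith
  refine ((hasDerivAt_const t μ).div (((hasDerivAt_id t).const_sub T).const_mul 2)
    (mul_ne_zero two_ne_zero h)).congr_deriv ?_
  simp only [id]
  field_simp
  ring

theorem hasDerivAt_swirl_βμ (μ T s : ℝ) {t : ℝ} (ht : t < T) (hs : s ≠ 0) :
    HasDerivAt (fun τ => swirl (βμ μ T τ) s)
      (βμ μ T t / (4 * (T - t)) * Real.exp (-(βμ μ T t * s) / 4)) t := by
  have h : T - t ≠ 0 := by linarith
  have hβ : HasDerivAt (fun τ => βμ μ T τ) (βμ μ T t / (T - t)) t := by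
    unfold βμ
    refine ((hasDerivAt_const t (μ - 1)).div ((hasDerivAt_id t).const_sub T) h).congr_deriv ?_
    simp only [id]
    field_simp
    ring
  refine ((((((hβ.mul_const s).neg).div_const 4).exp).const_sub 1).div_const s).congr_deriv ?_
  simp only [Pi.neg_apply]
  field_simp

theorem hasDerivAt_integral_Ioi {h : ℝ → ℝ} {c u : ℝ} (hcu : c < u)
    (hint : IntegrableOn h (Set.Ioi c)) (hcont : ContinuousOn h (Set.Ioi c)) :
    HasDerivAt (fun v => ∫ r in Set.Ioi v, h r) (-h u) u := by
  have hc : ∀ v ∈ Set.Ioi c, IntervalIntegrable h volume u v := fun v hv =>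
    (intervalIntegrable_iff.2 (hint.mono_set fun r hr => (lt_min hcu hv).trans hr.1))
  have hu : ContinuousAt h u := hcont.continuousAt (Ioi_mem_nhds hcu)
  have hm : StronglyMeasurableAtFilter h (nhds u) :=
    hcont.stronglyMeasurableAtFilter isOpen_Ioi u hcu
  have hd := (intervalIntegral.integral_hasDerivAt_right (hc u hcu) hm hu).const_sub
    (∫ r in Set.Ioi u, h r)
  refine hd.congr_of_eventuallyEq ?_
  filter_upwards [Ioi_mem_nhds hcu] with v hv
  rw [← intervalIntegral.integral_interval_add_Ioi' (hc v hv)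
    (hint.mono_set (Set.Ioi_subset_Ioi (Set.mem_Ioi.1 hv).le))]
  ring

/-- The integrand in the pressure. -/
def pressureKernel (r : ℝ) : ℝ := (1 / r) * (1 - Real.exp (-r / 4)) * Real.exp (-r / 4)

theorem continuousOn_pressureKernel : ContinuousOn pressureKernel (Set.Ioi 0) := by
  have h : ContinuousOn (fun r : ℝ => 1 / r) (Set.Ioi 0) :=
    continuousOn_const.div continuousOn_id fun r hr => (Set.mem_Ioi.1 hr).ne'
  exact (h.mul (by fun_prop)).mul (by fun_prop)

theorem integrableOn_pressureKernel {c : ℝ} (hc : 0 < c) :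
    IntegrableOn pressureKernel (Set.Ioi c) := by
  have hexp := (integrableOn_exp_mul_Ioi (show (-1 / 4 : ℝ) < 0 by norm_num) c).const_mul (1 / c)
  refine hexp.mono' ((continuousOn_pressureKernel.mono
    (Set.Ioi_subset_Ioi hc.le)).aestronglyMeasurable measurableSet_Ioi) ?_
  refine (ae_restrict_iff' measurableSet_Ioi).2 (.of_forall fun r hr => ?_)
  have hcr : c < r := hr
  have hr0 : 0 < r := hc.trans hcr
  have h1 : Real.exp (-r / 4) ≤ 1 := Real.exp_le_one_iff.2 (by linarith)
  have h0 := Real.exp_pos (-r / 4)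
  have h2 : 0 ≤ 1 - Real.exp (-r / 4) := by linarith
  rw [pressureKernel, Real.norm_of_nonneg (by positivity), show -1 / 4 * r = -r / 4 by ring]
  gcongr
  calc 1 / r * (1 - Real.exp (-r / 4)) ≤ 1 / r * 1 := by gcongr; linarith
    _ ≤ 1 / c := by rw [mul_one]; gcongr

theorem hasDerivAt_integral_pressureKernel {u : ℝ} (hu : 0 < u) :
    HasDerivAt (fun v => ∫ r in Set.Ioi v, pressureKernel r) (-pressureKernel u) u :=
  hasDerivAt_integral_Ioi (half_lt_self hu) (integrableOn_pressureKernel (half_pos hu))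
    (continuousOn_pressureKernel.mono (Set.Ioi_subset_Ioi (half_pos hu).le))

theorem PsB_eq (μ α T : ℝ) {t : ℝ} (ht : t < T) (y : Fin 3 → ℝ) :
    PsB μ α T t y = μ / (2 * (T - t) ^ 2) / 2 * axisDistSq y +
      -(μ / (2 * (T - t) ^ 2)) * (y 2 * y 2) +
      -(1 / 2) * (VsB μ α T t y 0 * VsB μ α T t y 0 + VsB μ α T t y 1 * VsB μ α T t y 1 +
        VsB μ α T t y 2 * VsB μ α T t y 2) +
      -(α ^ 2 * βμ μ T t / (16 * Real.pi ^ 2)) *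
        ∫ r in Set.Ioi (βμ μ T t * axisDistSq y), pressureKernel r := by
  have h (c : ℝ) := ((hasDerivAt_strain_rate μ T ht).mul_const c).deriv
  simp only [PsB, h, Fin.sum_univ_three, axisDistSq, pressureKernel, strainVec, Matrix.cons_val]
  ring

theorem pd_PsB (μ α T : ℝ) {t : ℝ} (ht : t < T) (hβ : 0 < βμ μ T t) {x : Fin 3 → ℝ}
    (hx : 0 < axisDistSq x) (i : Fin 3) :
    pd i (PsB μ α T t) x = -(μ / (2 * (T - t) ^ 2)) * strainVec x i -
      ∑ j, VsB μ α T t x j * pd i (fun z => VsB μ α T t z j) x +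
      α ^ 2 * βμ μ T t ^ 2 / (8 * Real.pi ^ 2) * pressureKernel (βμ μ T t * axisDistSq x) *
        (![x 0, x 1, 0] : Fin 3 → ℝ) i := by
  have h0 := hasGrad_VsB_zero μ α T t hβ hx
  have h1 := hasGrad_VsB_one μ α T t hβ hx
  have h2 := hasGrad_VsB_two μ α T t x
  have hs := hasGrad_axisDistSq x
  have hI := HasGrad.comp (hasDerivAt_integral_pressureKernel (mul_pos hβ hx))
    (hs.const_mul (βμ μ T t))
  have hP := (((hs.const_mul (μ / (2 * (T - t) ^ 2) / 2)).add
    (((HasGrad.coord 2 x).mul (HasGrad.coord 2 x)).const_mul (-(μ / (2 * (T - t) ^ 2))))).add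
    ((((h0.mul h0).add (h1.mul h1)).add (h2.mul h2)).const_mul (-(1 / 2)))).add
    (hI.const_mul (-(α ^ 2 * βμ μ T t / (16 * Real.pi ^ 2))))
  rw [(hP.congr (PsB_eq μ α T ht) rfl).pd_eq, Fin.sum_univ_three, h0.pd_eq, h1.pd_eq, h2.pd_eq]
  simp only [Pi.add_apply, Pi.smul_apply, smul_eq_mul]
  fin_cases i <;> simp [strainVec] <;> ring

/-- The singular Burgers vortex `(V^{sB}, P^{sB})` solves the Navier–Stokes equations
`∂ₜV - ΔV + ∇P + (V·∇)V = 0`, `∇·V = 0` for `0 ≤ t < T*` and `x' ≠ 0`. -/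
theorem singular_burgers_vortex_solves_NS
    (μ α T : ℝ) (hμ : 1 < μ) (hT : 0 < T)
    (t : ℝ) (ht0 : 0 ≤ t) (htT : t < T)
    (x : Fin 3 → ℝ) (hx : ¬(x 0 = 0 ∧ x 1 = 0)) :
    (∀ i : Fin 3,
        deriv (fun s => VsB μ α T s x i) t -
            (∑ j, pd j (fun y => pd j (fun z => VsB μ α T t z i) y) x) +
            pd i (PsB μ α T t) x +
            ∑ j, VsB μ α T t x j * pd j (fun z => VsB μ α T t z i) x = 0) ∧
      (∑ i, pd i (fun z => VsB μ α T t z i) x = 0) := by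
  have hTt : 0 < T - t := sub_pos.2 htT
  have hβ (s : ℝ) (hs : s < T) : 0 < βμ μ T s := div_pos (by linarith) (by linarith)
  have hβt := hβ t htT
  have hs := axisDistSq_pos hx
  have h0 := hasGrad_VsB_zero μ α T t hβt hs
  have h1 := hasGrad_VsB_one μ α T t hβt hs
  have h2 := hasGrad_VsB_two μ α T t x
  have ha := hasDerivAt_strain_rate μ T htT
  have hw := hasDerivAt_swirl_βμ μ T (axisDistSq x) htT hs.ne'
  have hlt : ∀ᶠ s in nhds t, s < T := gt_mem_nhds htT
  have hs' := hs.ne'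
  have hTt' := hTt.ne'
  have hμ' : μ - 1 ≠ 0 := by linarith
  have hπ := Real.pi_ne_zero
  refine ⟨fun i => ?_, ?_⟩
  · rw [pd_PsB μ α T htT hβt hs]
    simp only [Fin.sum_univ_three (fun j => VsB μ α T t x j * _), h0.pd_eq, h1.pd_eq, h2.pd_eq]
    fin_cases i
    · have hd : deriv (fun s => VsB μ α T s x 0) t = _ :=
        (((ha.neg.mul_const (x 0)).add
          ((hw.const_mul (x 1)).const_mul (-(α / (2 * Real.pi))))).congr_of_eventuallyEq
          (hlt.mono fun s hs => VsB_apply_zero μ α T s (hβ s hs) x)).deriv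
      simp only [Fin.zero_eta, hd, laplacian_VsB_zero μ α T t hβt hs, h0.pd_eq]
      simp [VsB_apply_zero μ α T t hβt, VsB_apply_one μ α T t hβt, strainVec, pressureKernel]
      rw [← neg_div]
      have hβμ : μ = 1 + βμ μ T t * (T - t) := by unfold βμ; field_simp; ring
      simp only [swirl, swirlDeriv, swirlDeriv₂]
      generalize Real.exp (-(βμ μ T t * axisDistSq x) / 4) = E
      generalize βμ μ T t = b at *
      unfold axisDistSq at *
      subst hβμ
      field_simp
      ring
    · have hd : deriv (fun s => VsB μ α T s x 1) t = _ :=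
        (((ha.neg.mul_const (x 1)).add
          ((hw.const_mul (x 0)).const_mul (α / (2 * Real.pi)))).congr_of_eventuallyEq
          (hlt.mono fun s hs => VsB_apply_one μ α T s (hβ s hs) x)).deriv
      simp only [Fin.mk_one, hd, laplacian_VsB_one μ α T t hβt hs, h1.pd_eq]
      simp [VsB_apply_zero μ α T t hβt, VsB_apply_one μ α T t hβt, strainVec, pressureKernel]
      rw [← neg_div]
      have hβμ : μ = 1 + βμ μ T t * (T - t) := by unfold βμ; field_simp; ring
      simp only [swirl, swirlDeriv, swirlDeriv₂]
      generalize Real.exp (-(βμ μ T t * axisDistSq x) / 4) = E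
      generalize βμ μ T t = b at *
      unfold axisDistSq at *
      subst hβμ
      field_simp
      ring
    · have hd : deriv (fun s => VsB μ α T s x 2) t = _ :=
        (((ha.const_mul 2).mul_const (x 2)).congr_of_eventuallyEq
          (Filter.Eventually.of_forall fun s => VsB_apply_two μ α T s x)).deriv
      simp only [Fin.reduceFinMk, hd, laplacian_VsB_two, h2.pd_eq]
      simp [VsB_apply_two, strainVec]
      ring
  · rw [Fin.sum_univ_three, h0.pd_eq, h1.pd_eq, h2.pd_eq]
    simp
    ring

end
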